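/- arXiv:1311.0313 — 2 statements merged into one kernel-verified Lean document; each statement's English description precedes it below -/
import Mathlib

section
/- Let n ≥ 1 be a natural number and λ ≠ 0 a real constant. If y : ℝ → ℝ is infinitely differentiable, y(x) > 0 for all x, and y satisfies y^(2n)(x) + λ · y(x)^((1+2n)/(1-2n)) = 0 for all x ∈ ℝ, then the function I₁(x) = (y^(n)(x))²/2 + (-1)^n · λ · ((1-2n)/2) · y(x)^(2/(1-2n)) + Σ_{j=0}^{n-1} (-1)^{n-j} · y^(j+1)(x) · y^(2n-j-1)(x) is constant on ℝ. -/
theorem ContDiff.hasDerivAt_iteratedDeriv {y : ℝ → ℝ} (hy : ContDiff ℝ (⊤ : ℕ∞) y)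
    (k : ℕ) (x : ℝ) :
    HasDerivAt (iteratedDeriv k y) (iteratedDeriv (k + 1) y x) x := by
  rw [iteratedDeriv_succ]
  exact (hy.differentiable_iteratedDeriv k (by exact_mod_cast WithTop.coe_lt_top k) x).hasDerivAt

/-- The alternating sum of products of derivatives telescopes under differentiation. -/
theorem hasDerivAt_alternating_sum {y : ℝ → ℝ} (hy : ContDiff ℝ (⊤ : ℕ∞) y) (n : ℕ) (x : ℝ) :
    HasDerivAt (fun x => ∑ j ∈ Finset.range n, (-1 : ℝ) ^ (n - j)
        * iteratedDeriv (j + 1) y x * iteratedDeriv (2 * n - j - 1) y x)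
      ((-1 : ℝ) ^ n * iteratedDeriv 1 y x * iteratedDeriv (2 * n) y x
        - iteratedDeriv (n + 1) y x * iteratedDeriv n y x) x := by
  let F : ℕ → ℝ := fun j =>
    (-1 : ℝ) ^ (n - j) * iteratedDeriv (j + 1) y x * iteratedDeriv (2 * n - j) y x
  have htel : ∑ j ∈ Finset.range n, (F j - F (j + 1)) =
      (-1 : ℝ) ^ n * iteratedDeriv 1 y x * iteratedDeriv (2 * n) y x
        - iteratedDeriv (n + 1) y x * iteratedDeriv n y x := by
    rw [Finset.sum_range_sub']
    simp [F, two_mul]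
  rw [← htel]
  refine HasDerivAt.fun_sum fun j hj => ?_
  obtain ⟨m, rfl⟩ : ∃ m, n = j + 1 + m :=
    Nat.exists_eq_add_of_le (Finset.mem_range.mp hj)
  have h := ((hy.hasDerivAt_iteratedDeriv (j + 1) x).const_mul
    ((-1 : ℝ) ^ (j + 1 + m - j))).mul
    (hy.hasDerivAt_iteratedDeriv (2 * (j + 1 + m) - j - 1) x)
  refine h.congr_deriv ?_
  simp only [F]
  rw [show j + 1 + m - j = m + 1 by omega, show j + 1 + m - (j + 1) = m by omega,
    show 2 * (j + 1 + m) - j - 1 + 1 = 2 * (j + 1 + m) - j by omega,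
    show 2 * (j + 1 + m) - (j + 1) = 2 * (j + 1 + m) - j - 1 by omega]
  ring

/-- The first integral `I₁` (translation symmetry) of the critical-exponent equation
`y^(2n) + λ y^((1+2n)/(1-2n)) = 0` is constant on solutions. -/
theorem stmt_1 (n : ℕ) (hn : 1 ≤ n) (lam : ℝ) (hlam : lam ≠ 0)
    (y : ℝ → ℝ) (hy : ContDiff ℝ (⊤ : ℕ∞) y) (hpos : ∀ x, 0 < y x)
    (heq : ∀ x, iteratedDeriv (2 * n) y x
      + lam * (y x) ^ ((1 + 2 * (n : ℝ)) / (1 - 2 * (n : ℝ))) = 0) :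
    ∃ C : ℝ, ∀ x : ℝ,
      (iteratedDeriv n y x) ^ 2 / 2
        + (-1 : ℝ) ^ n * lam * ((1 - 2 * (n : ℝ)) / 2) * (y x) ^ (2 / (1 - 2 * (n : ℝ)))
        + ∑ j ∈ Finset.range n, (-1 : ℝ) ^ (n - j)
            * iteratedDeriv (j + 1) y x * iteratedDeriv (2 * n - j - 1) y x = C := by
  have hne : 1 - 2 * (n : ℝ) ≠ 0 := by
    have : (1 : ℝ) ≤ n := by exact_mod_cast hn
    linarith
  have hexp : 2 / (1 - 2 * (n : ℝ)) - 1 = (1 + 2 * (n : ℝ)) / (1 - 2 * (n : ℝ)) := by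
    field_simp
    ring
  have hderiv : ∀ x, HasDerivAt (fun x => (iteratedDeriv n y x) ^ 2 / 2
        + (-1 : ℝ) ^ n * lam * ((1 - 2 * (n : ℝ)) / 2) * (y x) ^ (2 / (1 - 2 * (n : ℝ)))
        + ∑ j ∈ Finset.range n, (-1 : ℝ) ^ (n - j)
            * iteratedDeriv (j + 1) y x * iteratedDeriv (2 * n - j - 1) y x) 0 x := by
    intro x
    have hy' : HasDerivAt y (iteratedDeriv 1 y x) x := by
      simpa using hy.hasDerivAt_iteratedDeriv 0 x
    have hpow := (hy'.rpow_const (p := 2 / (1 - 2 * (n : ℝ))) (Or.inl (hpos x).ne')).const_mul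
      ((-1 : ℝ) ^ n * lam * ((1 - 2 * (n : ℝ)) / 2))
    have hsq := ((hy.hasDerivAt_iteratedDeriv n x).pow 2).div_const 2
    refine ((hsq.add hpow).add (hasDerivAt_alternating_sum hy n x)).congr_deriv ?_
    rw [hexp, eq_neg_of_add_eq_zero_left (heq x)]
    field_simp
    ring
  exact ⟨_, fun x => is_const_of_deriv_eq_zero (fun x => (hderiv x).differentiableAt)
    (fun x => (hderiv x).deriv) x 0⟩
end

section
/- Let λ < 0 and α, β, γ ∈ ℝ with β² − αγ ≠ 0, and set q(x) = α + 2βx + γx². Then for every x with q(x) > 0, the function y(x) = ( −λ / (9(β² − αγ)²) )^(3/8) · q(x)^(3/2) satisfies y''''(x) + λ · y(x)^(-5/3) = 0. -/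
theorem eqOn_iteratedDeriv_succ {f g g' : ℝ → ℝ} {U : Set ℝ} (hU : IsOpen U) {n : ℕ}
    (h : Set.EqOn (iteratedDeriv n f) g U) (hg : ∀ t ∈ U, HasDerivAt g (g' t) t) :
    Set.EqOn (iteratedDeriv (n + 1) f) g' U := by
  intro t ht
  rw [iteratedDeriv_succ, (h.eventuallyEq_of_mem (hU.mem_nhds ht)).deriv_eq]
  exact (hg t ht).deriv

theorem hasDerivAt_quadratic_rpow (α β γ p : ℝ) {t : ℝ}
    (ht : 0 < α + 2 * β * t + γ * t ^ 2) :
    HasDerivAt (fun t : ℝ => (α + 2 * β * t + γ * t ^ 2) ^ p)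
      (2 * (β + γ * t) * p * (α + 2 * β * t + γ * t ^ 2) ^ (p - 1)) t := by
  have h : HasDerivAt (fun t : ℝ => α + 2 * β * t + γ * t ^ 2) (2 * (β + γ * t)) t := by
    refine ((((hasDerivAt_id' t).const_mul (2 * β)).const_add α).add
      ((hasDerivAt_pow 2 t).const_mul γ)).congr_deriv ?_
    norm_num
    ring
  exact h.rpow_const (Or.inl ht.ne')

theorem iteratedDeriv_four_quadratic_rpow (c α β γ x : ℝ)
    (hq : 0 < α + 2 * β * x + γ * x ^ 2) :
    iteratedDeriv 4 (fun t : ℝ => c * (α + 2 * β * t + γ * t ^ 2) ^ ((3 : ℝ) / 2)) x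
      = c * (9 * (β ^ 2 - α * γ) ^ 2) * (α + 2 * β * x + γ * x ^ 2) ^ (-(5 : ℝ) / 2) := by
  set q : ℝ → ℝ := fun t => α + 2 * β * t + γ * t ^ 2 with hq_def
  have hU : IsOpen {t : ℝ | 0 < q t} := isOpen_lt continuous_const (by fun_prop)
  have hu (t : ℝ) : HasDerivAt (fun t : ℝ => β + γ * t) γ t := by
    simpa using ((hasDerivAt_id t).const_mul γ).const_add β
  have hr (p : ℝ) {t : ℝ} (ht : 0 < q t) : HasDerivAt (fun t => q t ^ p)
      (2 * (β + γ * t) * p * q t ^ (p - 1)) t := hasDerivAt_quadratic_rpow α β γ p ht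
  have h0 : Set.EqOn (iteratedDeriv 0 fun t => c * q t ^ ((3 : ℝ) / 2))
      (fun t => c * q t ^ ((3 : ℝ) / 2)) {t | 0 < q t} := by
    intro t _
    simp
  have h1 := eqOn_iteratedDeriv_succ hU
    (g' := fun t => c * (3 * ((β + γ * t) * q t ^ ((1 : ℝ) / 2)))) h0 (by
      intro t ht
      refine ((hr (3 / 2) ht).const_mul c).congr_deriv ?_
      rw [show (3 : ℝ) / 2 - 1 = 1 / 2 by norm_num]
      ring)
  have h2 := eqOn_iteratedDeriv_succ hU
    (g' := fun t => c * (3 * (γ * q t ^ ((1 : ℝ) / 2)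
      + (β + γ * t) ^ 2 * q t ^ (-(1 : ℝ) / 2)))) h1 (by
      intro t ht
      refine ((((hu t).mul (hr (1 / 2) ht)).const_mul 3).const_mul c).congr_deriv ?_
      rw [show (1 : ℝ) / 2 - 1 = -1 / 2 by norm_num]
      ring)
  have h3 := eqOn_iteratedDeriv_succ hU
    (g' := fun t => c * (3 * (3 * γ * ((β + γ * t) * q t ^ (-(1 : ℝ) / 2))
        - (β + γ * t) ^ 3 * q t ^ (-(3 : ℝ) / 2)))) h2 (by
      intro t ht
      refine (((((hr (1 / 2) ht).const_mul γ).add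
        (((hu t).pow 2).mul (hr (-1 / 2) ht))).const_mul 3).const_mul c).congr_deriv ?_
      rw [show (1 : ℝ) / 2 - 1 = -1 / 2 by norm_num,
        show (-1 : ℝ) / 2 - 1 = -3 / 2 by norm_num]
      simp only [Pi.pow_apply]
      push_cast
      ring)
  have h4 := eqOn_iteratedDeriv_succ hU
    (g' := fun t => c * (9 * (γ ^ 2 * q t ^ (-(1 : ℝ) / 2)
        - 2 * γ * (β + γ * t) ^ 2 * q t ^ (-(3 : ℝ) / 2)
        + (β + γ * t) ^ 4 * q t ^ (-(5 : ℝ) / 2)))) h3 (by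
      intro t ht
      refine ((((((hu t).mul (hr (-1 / 2) ht)).const_mul (3 * γ)).sub
        (((hu t).pow 3).mul (hr (-3 / 2) ht))).const_mul 3).const_mul c).congr_deriv ?_
      rw [show (-1 : ℝ) / 2 - 1 = -3 / 2 by norm_num,
        show (-3 : ℝ) / 2 - 1 = -5 / 2 by norm_num]
      simp only [Pi.pow_apply]
      push_cast
      ring)
  have hq' : 0 < q x := hq
  have e1 : q x ^ (-(1 : ℝ) / 2) = q x ^ 2 * q x ^ (-(5 : ℝ) / 2) := by
    rw [← Real.rpow_natCast, ← Real.rpow_add hq']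
    norm_num
  have e3 : q x ^ (-(3 : ℝ) / 2) = q x * q x ^ (-(5 : ℝ) / 2) := by
    rw [← Real.rpow_one_add' hq'.le (by norm_num)]
    norm_num
  refine (h4 hq').trans ?_
  simp only [e1, e3]
  change _ = c * (9 * (β ^ 2 - α * γ) ^ 2) * q x ^ (-(5 : ℝ) / 2)
  generalize q x ^ (-(5 : ℝ) / 2) = r
  simp only [hq_def]
  ring

/-- The exact solution `y = (−λ/(9(β² − αγ)²))^(3/8) (α + 2βx + γx²)^(3/2)` of the
fourth-order equation `y'''' + λ y^{-5/3} = 0` wherever the quadratic is positive. -/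
theorem stmt_12 (lam α β γ : ℝ) (hlam : lam < 0) (hd : β ^ 2 - α * γ ≠ 0) (x : ℝ)
    (hq : 0 < α + 2 * β * x + γ * x ^ 2) :
    iteratedDeriv 4
        (fun t : ℝ => (-lam / (9 * (β ^ 2 - α * γ) ^ 2)) ^ ((3 : ℝ) / 8)
          * (α + 2 * β * t + γ * t ^ 2) ^ ((3 : ℝ) / 2)) x
      + lam * ((-lam / (9 * (β ^ 2 - α * γ) ^ 2)) ^ ((3 : ℝ) / 8)
          * (α + 2 * β * x + γ * x ^ 2) ^ ((3 : ℝ) / 2)) ^ (-5 / 3 : ℝ) = 0 := by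
  rw [iteratedDeriv_four_quadratic_rpow _ α β γ x hq]
  have hD : 0 < 9 * (β ^ 2 - α * γ) ^ 2 := by positivity
  set D := 9 * (β ^ 2 - α * γ) ^ 2
  set q := α + 2 * β * x + γ * x ^ 2
  have hk : 0 < -lam / D := div_pos (neg_pos.mpr hlam) hD
  have hlamD : lam = -((-lam / D) * D) := by
    field_simp
  have hpow : (-lam / D) ^ ((3 : ℝ) / 8) = (-lam / D) * (-lam / D) ^ (-(5 : ℝ) / 8) := by
    rw [← Real.rpow_one_add' hk.le (by norm_num)]
    norm_num
  rw [Real.mul_rpow (by positivity) (by positivity), ← Real.rpow_mul hk.le,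
    ← Real.rpow_mul hq.le, show (3 : ℝ) / 8 * (-5 / 3) = -5 / 8 by norm_num,
    show (3 : ℝ) / 2 * (-5 / 3) = -5 / 2 by norm_num, hpow]
  linear_combination (-lam / D) ^ (-(5 : ℝ) / 8) * q ^ (-(5 : ℝ) / 2) * hlamD
end
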